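/- Let A be a Hopf algebra over a field k and let σ be a 2-cocycle on A with convolution inverse σ⁻¹. Then the twisted object A_σ — the underlying coalgebra of A with multiplication x · y = Σ σ(x₁,y₁) x₂y₂ σ⁻¹(x₃,y₃) — is again a Hopf algebra: the twisted multiplication is associative with unit 1, the original comultiplication Δ and counit ε are algebra homomorphisms with respect to it, and A_σ admits an antipode. -/

import Mathlib

/-!
STATEMENT 5: Let A be a Hopf algebra over a field k and σ a 2-cocycle on A with convolution
inverse σ⁻¹.  Then the twist A_σ, with multiplication x·y = Σ σ(x₁,y₁) x₂y₂ σ⁻¹(x₃,y₃), is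
again a Hopf algebra: the twisted multiplication is associative with unit 1, the original Δ
and ε are algebra homomorphisms with respect to it, and A_σ admits an antipode.
-/

open TensorProduct Coalgebra LinearMap

noncomputable section

variable {k : Type} [Field k]

/-- Convolution product of linear maps from a coalgebra `C` to an algebra `M`:
`(f * g)(c) = Σ f(c₁) g(c₂)`. -/
def conv {C M : Type} [AddCommGroup C] [Module k C] [Coalgebra k C]
    [Ring M] [Algebra k M] (f g : C →ₗ[k] M) : C →ₗ[k] M :=
  (LinearMap.mul' k M) ∘ₗ (TensorProduct.map f g) ∘ₗ Coalgebra.comul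

/-- The multiplication of the cocycle twist `A_σ`:
`x · y = Σ σ(x₁,y₁) x₂y₂ σ⁻¹(x₃,y₃)`, as a linear map `A ⊗ A → A`. -/
def twistMul {A : Type} [Ring A] [Algebra k A] [Coalgebra k A]
    (σ σi : A ⊗[k] A →ₗ[k] k) : A ⊗[k] A →ₗ[k] A :=
  conv (conv ((Algebra.linearMap k A) ∘ₗ σ) (LinearMap.mul' k A))
    ((Algebra.linearMap k A) ∘ₗ σi)

variable {A : Type} [Ring A] [HopfAlgebra k A]

section ScalarMap
variable {C D : Type} [AddCommGroup C] [Module k C] [AddCommGroup D] [Module k D]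

/-- The exterior product `c ⊗ d ↦ s c * t d` of two linear forms. -/
def scalarMap (s : C →ₗ[k] k) (t : D →ₗ[k] k) : C ⊗[k] D →ₗ[k] k :=
  LinearMap.mul' k k ∘ₗ TensorProduct.map s t

@[simp]
lemma scalarMap_tmul (s : C →ₗ[k] k) (t : D →ₗ[k] k) (c : C) (d : D) :
    scalarMap s t (c ⊗ₜ d) = s c * t d := rfl

end ScalarMap

section Convolution
variable {C D M N : Type} [AddCommGroup C] [Module k C] [Coalgebra k C] [AddCommGroup D]
  [Module k D] [Coalgebra k D] [Ring M] [Algebra k M] [Ring N] [Algebra k N]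

lemma conv_assoc (f g h : C →ₗ[k] M) : conv (conv f g) h = conv f (conv g h) :=
  congrArg WithConv.ofConv (mul_assoc (WithConv.toConv f) (WithConv.toConv g) (WithConv.toConv h))

lemma one_conv (f : C →ₗ[k] M) : conv (Algebra.linearMap k M ∘ₗ counit) f = f :=
  congrArg WithConv.ofConv (one_mul (WithConv.toConv f))

lemma conv_one (f : C →ₗ[k] M) : conv f (Algebra.linearMap k M ∘ₗ counit) = f :=
  congrArg WithConv.ofConv (mul_one (WithConv.toConv f))

lemma counit_conv (f : C →ₗ[k] k) : conv counit f = f :=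
  one_conv f

lemma conv_counit (f : C →ₗ[k] k) : conv f counit = f :=
  conv_one f

lemma conv_comp (f g : C →ₗ[k] M) (h : D →ₗc[k] C) :
    conv f g ∘ₗ h.toLinearMap = conv (f ∘ₗ h.toLinearMap) (g ∘ₗ h.toLinearMap) :=
  convMul_comp_coalgHom_distrib (WithConv.toConv f) (WithConv.toConv g) h

lemma algHom_comp_conv (h : M →ₐ[k] N) (f g : C →ₗ[k] M) :
    h.toLinearMap ∘ₗ conv f g = conv (h.toLinearMap ∘ₗ f) (h.toLinearMap ∘ₗ g) :=
  algHom_comp_convMul_distrib h (WithConv.toConv f) (WithConv.toConv g)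

lemma linearMap_comp_conv (s t : C →ₗ[k] k) :
    Algebra.linearMap k M ∘ₗ conv s t
      = conv (Algebra.linearMap k M ∘ₗ s) (Algebra.linearMap k M ∘ₗ t) :=
  algHom_comp_conv (Algebra.ofId k M) s t

lemma conv_apply {ι : Type*} {c : C} (r : Repr k c ι) (f g : C →ₗ[k] M) :
    conv f g c = ∑ i ∈ r.index, f (r.left i) * g (r.right i) :=
  r.convMul_apply (WithConv.toConv f) (WithConv.toConv g)

lemma conv_tmul {ι κ : Type*} {c : C} {d : D} (r : Repr k c ι)
    (q : Repr k d κ) (f g : C ⊗[k] D →ₗ[k] M) :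
    conv f g (c ⊗ₜ d) = ∑ i ∈ r.index, ∑ j ∈ q.index,
      f (r.left i ⊗ₜ q.left j) * g (r.right i ⊗ₜ q.right j) := by
  simp only [conv, LinearMap.comp_apply, TensorProduct.comul_tmul, ← r.eq, ← q.eq,
    TensorProduct.sum_tmul, TensorProduct.tmul_sum, map_sum]
  rw [Finset.sum_comm]
  simp

lemma comp_scalar_conv (g : M →ₗ[k] N) (s : C →ₗ[k] k) (f : C →ₗ[k] M) :
    g ∘ₗ conv (Algebra.linearMap k M ∘ₗ s) f = conv (Algebra.linearMap k N ∘ₗ s) (g ∘ₗ f) := by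
  ext c
  simp [conv_apply (ℛ k c), ← Algebra.smul_def]

lemma comp_conv_scalar (g : M →ₗ[k] N) (f : C →ₗ[k] M) (s : C →ₗ[k] k) :
    g ∘ₗ conv f (Algebra.linearMap k M ∘ₗ s) = conv (g ∘ₗ f) (Algebra.linearMap k N ∘ₗ s) := by
  ext c
  simp [conv_apply (ℛ k c), ← Algebra.commutes, ← Algebra.smul_def]

lemma scalar_conv_apply {ι : Type*} {c : C} (r : Repr k c ι) (s : C →ₗ[k] k) (f : C →ₗ[k] M) :
    conv (Algebra.linearMap k M ∘ₗ s) f c = ∑ i ∈ r.index, s (r.left i) • f (r.right i) := by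
  simp [conv_apply r, ← Algebra.smul_def]

lemma conv_scalar_apply {ι : Type*} {c : C} (r : Repr k c ι) (s : C →ₗ[k] k) (f : C →ₗ[k] M) :
    conv f (Algebra.linearMap k M ∘ₗ s) c = ∑ i ∈ r.index, s (r.right i) • f (r.left i) := by
  simp [conv_apply r, ← Algebra.commutes, ← Algebra.smul_def]

/-- The product `s * f * t` of `f` with the scalar-valued maps `s` and `t`. -/
def convTwist (s t : C →ₗ[k] k) (f : C →ₗ[k] M) : C →ₗ[k] M :=
  conv (conv (Algebra.linearMap k M ∘ₗ s) f) (Algebra.linearMap k M ∘ₗ t)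

lemma comp_convTwist (g : M →ₗ[k] N) (s t : C →ₗ[k] k) (f : C →ₗ[k] M) :
    g ∘ₗ convTwist s t f = convTwist s t (g ∘ₗ f) := by
  rw [convTwist, comp_conv_scalar, comp_scalar_conv, convTwist]

lemma convTwist_comp (s t : C →ₗ[k] k) (f : C →ₗ[k] M) (h : D →ₗc[k] C) :
    convTwist s t f ∘ₗ h.toLinearMap
      = convTwist (s ∘ₗ h.toLinearMap) (t ∘ₗ h.toLinearMap) (f ∘ₗ h.toLinearMap) := by
  simp only [convTwist, conv_comp, LinearMap.comp_assoc]

lemma convTwist_convTwist (s t s' t' : C →ₗ[k] k) (f : C →ₗ[k] M) :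
    convTwist s t (convTwist s' t' f) = convTwist (conv s s') (conv t' t) f := by
  simp only [convTwist, linearMap_comp_conv, conv_assoc]

lemma convTwist_counit {s t : C →ₗ[k] k} (h : conv s t = counit) :
    convTwist s t (Algebra.linearMap k M ∘ₗ counit) = Algebra.linearMap k M ∘ₗ counit := by
  rw [convTwist, conv_one, ← linearMap_comp_conv, h]

lemma convTwist_conv {s t : C →ₗ[k] k} (h : conv t s = counit) (f g : C →ₗ[k] M) :
    convTwist s t (conv f g) = conv (convTwist s t f) (convTwist s t g) := by
  have h' : conv (Algebra.linearMap k M ∘ₗ t) (Algebra.linearMap k M ∘ₗ s)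
      = Algebra.linearMap k M ∘ₗ counit := by rw [← linearMap_comp_conv, h]
  have h'' (F : C →ₗ[k] M) : conv (Algebra.linearMap k M ∘ₗ t)
      (conv (Algebra.linearMap k M ∘ₗ s) F) = F := by rw [← conv_assoc, h', one_conv]
  simp only [convTwist, conv_assoc, h'']

lemma map_comp_comul (f g : C →ₗ[k] M) :
    TensorProduct.map f g ∘ₗ comul
      = conv ((Algebra.TensorProduct.includeLeft (S := k) : M →ₐ[k] M ⊗[k] M).toLinearMap ∘ₗ f)
          ((Algebra.TensorProduct.includeRight : M →ₐ[k] M ⊗[k] M).toLinearMap ∘ₗ g) := by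
  ext c
  simp [conv_apply (ℛ k c), ← (ℛ k c).eq]

lemma comul_comp_convTwist [Coalgebra k M] {s t : C →ₗ[k] k} (h : conv t s = counit)
    {f : C →ₗ[k] M} (hf : comul ∘ₗ f = TensorProduct.map f f ∘ₗ comul) :
    comul ∘ₗ convTwist s t f = TensorProduct.map (convTwist s t f) (convTwist s t f) ∘ₗ comul := by
  rw [comp_convTwist, hf, map_comp_comul, convTwist_conv h, map_comp_comul, comp_convTwist,
    comp_convTwist]

lemma comul_four :
    (TensorProduct.assoc k C C C).symm.toLinearMap.lTensor C ∘ₗ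
      (TensorProduct.assoc k C C (C ⊗[k] C)).toLinearMap ∘ₗ
        TensorProduct.map comul comul ∘ₗ comul
      = (comul.rTensor C ∘ₗ comul).lTensor C ∘ₗ (comul (R := k) (A := C)) := by
  simp [coassoc_simps]

lemma map_conv (f h : C →ₗ[k] M) (g l : D →ₗ[k] N) :
    TensorProduct.map (conv f h) (conv g l)
      = conv (TensorProduct.map f g) (TensorProduct.map h l) :=
  (congrArg WithConv.ofConv (TensorProduct.map_convMul_map (f := WithConv.toConv f)
    (h := WithConv.toConv h) (g := WithConv.toConv g) (k := WithConv.toConv l))).symm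

lemma scalarMap_counit_counit :
    scalarMap (counit (R := k) (A := C)) (counit (R := k) (A := D)) = counit := by
  ext c d
  simp [mul_comm]

lemma conv_scalarMap (s s' : C →ₗ[k] k) (t t' : D →ₗ[k] k) :
    conv (scalarMap s t) (scalarMap s' t') = scalarMap (conv s s') (conv t t') := by
  ext c d
  simp only [TensorProduct.AlgebraTensorModule.curry_apply, LinearMap.restrictScalars_self,
    TensorProduct.curry_apply, conv_tmul (ℛ k c) (ℛ k d), conv_apply (ℛ k c),
    conv_apply (ℛ k d), scalarMap_tmul,
    Finset.sum_mul_sum, mul_mul_mul_comm]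

lemma map_convTwist (s t : C →ₗ[k] k) (s' t' : D →ₗ[k] k) (f : C →ₗ[k] M) (g : D →ₗ[k] N) :
    TensorProduct.map (convTwist s t f) (convTwist s' t' g)
      = convTwist (scalarMap s s') (scalarMap t t') (TensorProduct.map f g) := by
  have h (s : C →ₗ[k] k) (s' : D →ₗ[k] k) :
      TensorProduct.map (Algebra.linearMap k M ∘ₗ s) (Algebra.linearMap k N ∘ₗ s')
        = Algebra.linearMap k (M ⊗[k] N) ∘ₗ scalarMap s s' := by
    ext c d
    simp [Algebra.algebraMap_eq_smul_one, mul_smul, smul_comm (s _) (s' _),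
      ← TensorProduct.smul_tmul', Algebra.TensorProduct.one_def]
  simp only [convTwist, map_conv, h]

lemma convTwist_counit_counit (f : C →ₗ[k] M) : convTwist counit counit f = f := by
  rw [convTwist, one_conv, conv_one]

lemma left_eq_of_conv_eq {s t s' t' : C →ₗ[k] k} (h : conv t s = counit) (h' : conv s' t' = counit)
    (hs : s = s') : t = t' := by
  subst hs
  rw [← conv_counit t, ← h', ← conv_assoc, h, counit_conv]

lemma conv_scalarMap_counit_tmul (s : C →ₗ[k] k) (F : C ⊗[k] D →ₗ[k] k) (c : C) (d : D) :
    conv (scalarMap s counit) F (c ⊗ₜ d)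
      = conv s (F ∘ₗ (TensorProduct.mk k C D).flip d) c := by
  rw [conv_tmul (ℛ k c) (ℛ k d), conv_apply (ℛ k c)]
  refine Finset.sum_congr rfl fun i _ ↦ ?_
  conv_rhs => rw [← sum_counit_smul (ℛ k d)]
  simp [Finset.mul_sum, mul_assoc]

lemma conv_scalarMap_counit_tmul' (s : D →ₗ[k] k) (F : C ⊗[k] D →ₗ[k] k) (c : C) (d : D) :
    conv (scalarMap counit s) F (c ⊗ₜ d)
      = conv s (F ∘ₗ TensorProduct.mk k C D c) d := by
  rw [conv_tmul (ℛ k c) (ℛ k d), conv_apply (ℛ k d), Finset.sum_comm]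
  refine Finset.sum_congr rfl fun i _ ↦ ?_
  conv_rhs => rw [← sum_counit_smul (ℛ k c)]
  simp [Finset.mul_sum, mul_assoc, mul_left_comm]

lemma sum_comul_four (T : C ⊗[k] ((C ⊗[k] C) ⊗[k] C) →ₗ[k] M) (c : C) :
    ∑ i ∈ (ℛ k c).index, ∑ j ∈ (ℛ k ((ℛ k c).left i)).index,
      ∑ l ∈ (ℛ k ((ℛ k c).right i)).index,
        T ((ℛ k ((ℛ k c).left i)).left j ⊗ₜ (((ℛ k ((ℛ k c).left i)).right j ⊗ₜ
          (ℛ k ((ℛ k c).right i)).left l) ⊗ₜ (ℛ k ((ℛ k c).right i)).right l))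
      = ∑ i ∈ (ℛ k c).index, ∑ j ∈ (ℛ k ((ℛ k c).right i)).index,
        T ((ℛ k c).left i ⊗ₜ (comul ((ℛ k ((ℛ k c).right i)).left j) ⊗ₜ
          (ℛ k ((ℛ k c).right i)).right j)) := by
  have h := congr(T ($(comul_four (k := k) (C := C)) c))
  have e (c : C) : comul c = ∑ i ∈ (ℛ k c).index, (ℛ k c).left i ⊗ₜ[k] (ℛ k c).right i :=
    (ℛ k c).eq.symm
  simp only [LinearMap.comp_apply, LinearMap.lTensor_def, LinearMap.rTensor_def] at h
  rw [e c] at h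
  simp only [map_sum, TensorProduct.map_tmul, LinearMap.id_apply, LinearMap.comp_apply] at h
  convert h using 2 with i _ i _
  · rw [e ((ℛ k c).left i), e ((ℛ k c).right i)]
    simp only [TensorProduct.sum_tmul, TensorProduct.tmul_sum, map_sum, TensorProduct.assoc_tmul,
      TensorProduct.map_tmul, LinearMap.id_apply, LinearEquiv.coe_coe,
      TensorProduct.assoc_symm_tmul]
    exact Finset.sum_comm
  · rw [e ((ℛ k c).right i)]
    simp [TensorProduct.tmul_sum]

lemma comp_map_conv_scalar_comp_comul (F : M ⊗[k] M →ₗ[k] N) (f g : C →ₗ[k] M) (w : C →ₗ[k] k) :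
    F ∘ₗ TensorProduct.map f (conv g (Algebra.linearMap k M ∘ₗ w)) ∘ₗ comul
      = conv (F ∘ₗ TensorProduct.map f g ∘ₗ comul) (Algebra.linearMap k N ∘ₗ w) := by
  ext c
  have h := congr(((TensorProduct.rid k N).toLinearMap ∘ₗ
    TensorProduct.map (F ∘ₗ TensorProduct.map f g) w ∘ₗ
    (TensorProduct.assoc k C C C).symm.toLinearMap)
    $(sum_tmul_tmul_eq (R := k) (ℛ k c) (fun _ ↦ ℛ k _) (fun _ ↦ ℛ k _)))
  simp only [map_sum] at h
  rw [conv_scalar_apply (ℛ k c)]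
  trans ∑ i ∈ (ℛ k c).index,
    F (f ((ℛ k c).left i) ⊗ₜ conv g (Algebra.linearMap k M ∘ₗ w) ((ℛ k c).right i))
  · simp [← (ℛ k c).eq]
  · convert h.symm using 2 with i _ i _
    · simp [conv_scalar_apply (ℛ k _), TensorProduct.tmul_sum]
    · simp [← (ℛ k ((ℛ k c).left i)).eq, Finset.smul_sum]

lemma comp_map_scalar_conv_comp_comul (F : M ⊗[k] M →ₗ[k] N) (f g : C →ₗ[k] M) (w : C →ₗ[k] k) :
    F ∘ₗ TensorProduct.map (conv (Algebra.linearMap k M ∘ₗ w) f) g ∘ₗ comul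
      = conv (Algebra.linearMap k N ∘ₗ w) (F ∘ₗ TensorProduct.map f g ∘ₗ comul) := by
  ext c
  have h := congr(((TensorProduct.lid k N).toLinearMap ∘ₗ
    TensorProduct.map w (F ∘ₗ TensorProduct.map f g))
    $(sum_tmul_tmul_eq (R := k) (ℛ k c) (fun _ ↦ ℛ k _) (fun _ ↦ ℛ k _)))
  simp only [map_sum] at h
  rw [scalar_conv_apply (ℛ k c)]
  trans ∑ i ∈ (ℛ k c).index,
    F (conv (Algebra.linearMap k M ∘ₗ w) f ((ℛ k c).left i) ⊗ₜ g ((ℛ k c).right i))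
  · simp [← (ℛ k c).eq]
  · convert h using 2 with i _ i _
    · simp [scalar_conv_apply (ℛ k _), TensorProduct.sum_tmul, ← TensorProduct.smul_tmul']
    · simp [← (ℛ k ((ℛ k c).right i)).eq, Finset.smul_sum]

lemma map_conv_scalar_comp_comul (f g : C →ₗ[k] M) (w : C →ₗ[k] k) :
    TensorProduct.map (conv f (Algebra.linearMap k M ∘ₗ w)) g ∘ₗ comul
      = TensorProduct.map f (conv (Algebra.linearMap k M ∘ₗ w) g) ∘ₗ comul := by
  ext c
  have h := congr((TensorProduct.map f
    ((TensorProduct.lid k M).toLinearMap ∘ₗ TensorProduct.map w g))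
    $(sum_tmul_tmul_eq (R := k) (ℛ k c) (fun _ ↦ ℛ k _) (fun _ ↦ ℛ k _)))
  simp only [map_sum] at h
  simp only [LinearMap.comp_apply]
  rw [← (ℛ k c).eq]
  simp only [map_sum, TensorProduct.map_tmul]
  convert h using 2 with i _ i _
  · simp [conv_scalar_apply (ℛ k _), TensorProduct.sum_tmul, ← TensorProduct.smul_tmul']
  · simp [scalar_conv_apply (ℛ k _), TensorProduct.tmul_sum]

end Convolution

section Antipode
open HopfAlgebra
variable {M : Type} [Ring M] [Algebra k M]

lemma comul_comp_antipode :
    comul ∘ₗ antipode k (A := A)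
      = TensorProduct.map (antipode k) (antipode k) ∘ₗ
          (TensorProduct.comm k A A).toLinearMap ∘ₗ comul := by
  apply WithConv.toConv_injective
  refine (left_inv_eq_right_inv ?_ comul_right_inv).symm
  ext x
  let T : A ⊗[k] ((A ⊗[k] A) ⊗[k] A) →ₗ[k] A ⊗[k] A :=
    TensorProduct.map LinearMap.id (LinearMap.mul' k A) ∘ₗ
    (TensorProduct.leftComm k A A A).toLinearMap ∘ₗ
    TensorProduct.map (antipode k)
      (TensorProduct.map (LinearMap.mul' k A ∘ₗ (antipode k).rTensor A) LinearMap.id)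
  have h := sum_comul_four T x
  have e (c : A) : comul c = ∑ i ∈ (ℛ k c).index, (ℛ k c).left i ⊗ₜ[k] (ℛ k c).right i :=
    (ℛ k c).eq.symm
  have h1 : ∀ i, ∑ j ∈ (ℛ k ((ℛ k x).right i)).index,
        T ((ℛ k x).left i ⊗ₜ (comul ((ℛ k ((ℛ k x).right i)).left j) ⊗ₜ
          (ℛ k ((ℛ k x).right i)).right j))
        = 1 ⊗ₜ (antipode k ((ℛ k x).left i) * (ℛ k x).right i) := by
    intro i
    conv_rhs => rw [← sum_counit_smul (ℛ k ((ℛ k x).right i))]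
    simp [T, Algebra.algebraMap_eq_smul_one, Finset.mul_sum, TensorProduct.tmul_sum,
      ← TensorProduct.smul_tmul']
  simp only [h1, ← TensorProduct.tmul_sum, sum_antipode_mul_eq_algebraMap_counit] at h
  rw [(ℛ k x).convMul_apply]
  simp only [LinearMap.comp_apply, convOne_apply]
  trans ((1:A) ⊗ₜ[k] (algebraMap k A) (counit x))
  · rw [← h]
    refine Finset.sum_congr rfl fun i _ ↦ ?_
    rw [e ((ℛ k x).left i), e ((ℛ k x).right i)]
    simp [T, Finset.sum_mul_sum]
  · simp [Algebra.algebraMap_eq_smul_one, Algebra.TensorProduct.one_def]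

/-- The linear map `x ↦ Σ f (x₁ ⊗ S x₂)`. -/
def antipodeRight (f : A ⊗[k] A →ₗ[k] M) : A →ₗ[k] M :=
  f ∘ₗ TensorProduct.map LinearMap.id (antipode k) ∘ₗ comul

/-- The linear map `x ↦ Σ f (S x₁ ⊗ x₂)`. -/
def antipodeLeft (f : A ⊗[k] A →ₗ[k] M) : A →ₗ[k] M :=
  f ∘ₗ TensorProduct.map (antipode k) LinearMap.id ∘ₗ comul

/-- The representation `Δ (S a) = Σ S a₂ ⊗ S a₁`. -/
@[simps]
def antipodeRepr {ι : Type*} {a : A} (r : Repr k a ι) : Repr k (antipode k a) ι where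
  index := r.index
  left i := antipode k (r.right i)
  right i := antipode k (r.left i)
  eq := by
    have h := congr($(comul_comp_antipode (k := k) (A := A)) a)
    simpa [← r.eq] using h.symm

lemma antipodeRight_apply {ι : Type*} {a : A} (r : Repr k a ι) (f : A ⊗[k] A →ₗ[k] M) :
    antipodeRight f a = ∑ i ∈ r.index, f (r.left i ⊗ₜ antipode k (r.right i)) := by
  simp [antipodeRight, ← r.eq]

lemma antipodeLeft_apply {ι : Type*} {a : A} (r : Repr k a ι) (f : A ⊗[k] A →ₗ[k] M) :
    antipodeLeft f a = ∑ i ∈ r.index, f (antipode k (r.left i) ⊗ₜ r.right i) := by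
  simp [antipodeLeft, ← r.eq]

lemma antipodeRight_conv (f g : A ⊗[k] A →ₗ[k] M) (v : A →ₗ[k] k)
    (hg : antipodeRight g = Algebra.linearMap k M ∘ₗ v) :
    antipodeRight (conv f g) = f ∘ₗ TensorProduct.map LinearMap.id
      (conv (Algebra.linearMap k A ∘ₗ v) (antipode k)) ∘ₗ comul := by
  ext x
  let T : A ⊗[k] ((A ⊗[k] A) ⊗[k] A) →ₗ[k] M :=
    LinearMap.mul' k M ∘ₗ (TensorProduct.comm k M M).toLinearMap ∘ₗ
    TensorProduct.map (g ∘ₗ TensorProduct.map LinearMap.id (antipode k))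
      (f ∘ₗ TensorProduct.map LinearMap.id (antipode k)) ∘ₗ
    (TensorProduct.leftComm k A (A ⊗[k] A) A).toLinearMap
  have hg' (y : A) : g (TensorProduct.map LinearMap.id (antipode k) (comul y))
      = algebraMap k M (v y) :=
    congr($hg y)
  have h := sum_comul_four T x
  rw [antipodeRight_apply (ℛ k x)]
  trans ∑ i ∈ (ℛ k x).index,
    f ((ℛ k x).left i ⊗ₜ conv (Algebra.linearMap k A ∘ₗ v) (antipode k) ((ℛ k x).right i))
  · convert h using 2 with i _ i _
    · rw [conv_tmul (ℛ k _) (antipodeRepr (ℛ k _))]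
      simp [T]
    · rw [scalar_conv_apply (ℛ k _)]
      simp [T, TensorProduct.tmul_sum, hg', ← Algebra.commutes, ← Algebra.smul_def]
  · simp [← (ℛ k x).eq]

lemma antipodeLeft_conv (f g : A ⊗[k] A →ₗ[k] M) (v : A →ₗ[k] k)
    (hf : antipodeLeft f = Algebra.linearMap k M ∘ₗ v) :
    antipodeLeft (conv f g) = g ∘ₗ TensorProduct.map
      (conv (antipode k) (Algebra.linearMap k A ∘ₗ v)) LinearMap.id ∘ₗ comul := by
  ext x
  let T : A ⊗[k] ((A ⊗[k] A) ⊗[k] A) →ₗ[k] M :=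
    LinearMap.mul' k M ∘ₗ
    TensorProduct.map (f ∘ₗ TensorProduct.map (antipode k) LinearMap.id)
      (g ∘ₗ TensorProduct.map (antipode k) LinearMap.id) ∘ₗ
    (TensorProduct.leftComm k A (A ⊗[k] A) A).toLinearMap
  have hf' (y : A) : f (TensorProduct.map (antipode k) LinearMap.id (comul y))
      = algebraMap k M (v y) :=
    congr($hf y)
  have h := sum_comul_four T x
  rw [antipodeLeft_apply (ℛ k x), map_conv_scalar_comp_comul]
  trans ∑ i ∈ (ℛ k x).index,
    g (antipode k ((ℛ k x).left i) ⊗ₜ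
      conv (Algebra.linearMap k A ∘ₗ v) LinearMap.id ((ℛ k x).right i))
  · convert h using 2 with i _ i _
    · rw [conv_tmul (antipodeRepr (ℛ k _)) (ℛ k _)]
      simp [T]
    · rw [scalar_conv_apply (ℛ k _)]
      simp [T, TensorProduct.tmul_sum, hf', ← Algebra.smul_def]
  · simp [← (ℛ k x).eq]

end Antipode

section Cocycle
open HopfAlgebra

variable (k A) in
/-- `(x ⊗ y) ⊗ z ↦ x y ⊗ z` as a coalgebra homomorphism. -/
def mulTmul : (A ⊗[k] A) ⊗[k] A →ₗc[k] A ⊗[k] A :=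
  Coalgebra.TensorProduct.map (Bialgebra.mulCoalgHom k A) (CoalgHom.id k A)

variable (k A) in
/-- `(x ⊗ y) ⊗ z ↦ x ⊗ (y ⊗ z)` as a coalgebra homomorphism. -/
def assocHom : (A ⊗[k] A) ⊗[k] A →ₗc[k] A ⊗[k] (A ⊗[k] A) :=
  (Coalgebra.TensorProduct.assoc k k A A A).toCoalgHom

variable (k A) in
/-- `(x ⊗ y) ⊗ z ↦ x ⊗ y z` as a coalgebra homomorphism. -/
def tmulMul : (A ⊗[k] A) ⊗[k] A →ₗc[k] A ⊗[k] A :=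
  (Coalgebra.TensorProduct.map (CoalgHom.id k A) (Bialgebra.mulCoalgHom k A)).comp (assocHom k A)

@[simp]
lemma mulTmul_tmul (x y z : A) : mulTmul k A ((x ⊗ₜ y) ⊗ₜ z) = (x * y) ⊗ₜ z := rfl

@[simp]
lemma tmulMul_tmul (x y z : A) : tmulMul k A ((x ⊗ₜ y) ⊗ₜ z) = x ⊗ₜ (y * z) := rfl

lemma twistMul_eq (σ σi : A ⊗[k] A →ₗ[k] k) :
    twistMul σ σi = convTwist σ σi (LinearMap.mul' k A) := rfl

variable {σ σi : A ⊗[k] A →ₗ[k] k}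

lemma cocycle_conv (hcoc : ∀ x y z : A,
      conv σ (σ ∘ₗ ((TensorProduct.mk k A A).flip z) ∘ₗ LinearMap.mul' k A) (x ⊗ₜ y)
        = conv σ (σ ∘ₗ (TensorProduct.mk k A A x) ∘ₗ LinearMap.mul' k A) (y ⊗ₜ z)) :
    conv (scalarMap σ counit) (σ ∘ₗ (mulTmul k A).toLinearMap)
      = conv (scalarMap counit σ ∘ₗ (assocHom k A).toLinearMap)
          (σ ∘ₗ (tmulMul k A).toLinearMap) := by
  have h : σ ∘ₗ (tmulMul k A).toLinearMap
      = (σ ∘ₗ TensorProduct.map LinearMap.id (LinearMap.mul' k A)) ∘ₗ (assocHom k A).toLinearMap :=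
    rfl
  rw [h, ← conv_comp]
  ext x y z
  refine (conv_scalarMap_counit_tmul _ _ _ _).trans
    (Eq.trans ?_ (conv_scalarMap_counit_tmul' _ _ _ _).symm)
  have h₁ : (σ ∘ₗ (mulTmul k A).toLinearMap) ∘ₗ (TensorProduct.mk k (A ⊗[k] A) A).flip z
      = σ ∘ₗ (TensorProduct.mk k A A).flip z ∘ₗ LinearMap.mul' k A := by
    ext; rfl
  have h₂ : (σ ∘ₗ TensorProduct.map LinearMap.id (LinearMap.mul' k A)) ∘ₗ
      TensorProduct.mk k A (A ⊗[k] A) x = σ ∘ₗ TensorProduct.mk k A A x ∘ₗ LinearMap.mul' k A := by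
    ext; rfl
  rw [h₁, h₂]
  exact hcoc x y z

lemma conv_comp_coalgHom_eq_counit {C D : Type} [AddCommGroup C] [Module k C] [Coalgebra k C]
    [AddCommGroup D] [Module k D] [Coalgebra k D] {s t : C →ₗ[k] k} (h : conv s t = counit)
    (φ : D →ₗc[k] C) : conv (s ∘ₗ φ.toLinearMap) (t ∘ₗ φ.toLinearMap) = counit := by
  rw [← conv_comp, h]
  exact φ.counit_comp

lemma conv_conv_eq_counit {C : Type} [AddCommGroup C] [Module k C] [Coalgebra k C]
    {s t s' t' : C →ₗ[k] k} (h : conv s t = counit) (h' : conv s' t' = counit) :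
    conv (conv s s') (conv t' t) = counit := by
  rw [conv_assoc, ← conv_assoc s', h', counit_conv, h]

lemma twistMul_assoc (hinv₁ : conv σ σi = counit) (hinv₂ : conv σi σ = counit)
    (hcoc : ∀ x y z : A,
      conv σ (σ ∘ₗ ((TensorProduct.mk k A A).flip z) ∘ₗ LinearMap.mul' k A) (x ⊗ₜ y)
        = conv σ (σ ∘ₗ (TensorProduct.mk k A A x) ∘ₗ LinearMap.mul' k A) (y ⊗ₜ z)) :
    twistMul σ σi ∘ₗ TensorProduct.map (twistMul σ σi) LinearMap.id
      = twistMul σ σi ∘ₗ TensorProduct.map LinearMap.id (twistMul σ σi)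
          ∘ₗ (assocHom k A).toLinearMap := by
  have hL : TensorProduct.map (twistMul σ σi) (LinearMap.id : A →ₗ[k] A)
      = convTwist (scalarMap σ counit) (scalarMap σi counit) (mulTmul k A).toLinearMap := by
    conv_lhs => rw [← convTwist_counit_counit (LinearMap.id : A →ₗ[k] A), twistMul_eq,
      map_convTwist]
    rfl
  have hR : TensorProduct.map (LinearMap.id : A →ₗ[k] A) (twistMul σ σi) ∘ₗ
      (assocHom k A).toLinearMap
      = convTwist (scalarMap counit σ ∘ₗ (assocHom k A).toLinearMap)
          (scalarMap counit σi ∘ₗ (assocHom k A).toLinearMap) (tmulMul k A).toLinearMap := by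
    conv_lhs => rw [← convTwist_counit_counit (LinearMap.id : A →ₗ[k] A), twistMul_eq,
      map_convTwist, convTwist_comp]
    rfl
  rw [hL, hR, comp_convTwist, comp_convTwist, twistMul_eq, convTwist_comp, convTwist_comp,
    convTwist_convTwist, convTwist_convTwist]
  have hm : LinearMap.mul' k A ∘ₗ (mulTmul k A).toLinearMap
      = LinearMap.mul' k A ∘ₗ (tmulMul k A).toLinearMap := by
    ext x y z
    exact mul_assoc x y z
  have e := cocycle_conv hcoc
  have e' := left_eq_of_conv_eq
    (conv_conv_eq_counit (conv_comp_coalgHom_eq_counit hinv₂ (mulTmul k A))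
      (show conv (scalarMap σi counit) (scalarMap σ counit) = counit by
        rw [conv_scalarMap, hinv₂, counit_conv, scalarMap_counit_counit]))
    (conv_conv_eq_counit
      (conv_comp_coalgHom_eq_counit
        (show conv (scalarMap counit σ) (scalarMap counit σi) = counit by
          rw [conv_scalarMap, hinv₁, counit_conv, scalarMap_counit_counit]) (assocHom k A))
      (conv_comp_coalgHom_eq_counit hinv₁ (tmulMul k A))) e
  rw [hm, e, e']

variable (k A) in
/-- `z ↦ 1 ⊗ z` as a coalgebra homomorphism. -/
def oneTmul : A →ₗc[k] A ⊗[k] A where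
  toLinearMap := TensorProduct.mk k A A 1
  counit_comp := by ext; simp
  map_comp_comul := by
    ext x
    simp [← (ℛ k x).eq, TensorProduct.tmul_sum, Algebra.TensorProduct.one_def]

variable (k A) in
/-- `x ↦ x ⊗ 1` as a coalgebra homomorphism. -/
def tmulOne : A →ₗc[k] A ⊗[k] A where
  toLinearMap := (TensorProduct.mk k A A).flip 1
  counit_comp := by ext; simp
  map_comp_comul := by
    ext x
    simp [← (ℛ k x).eq, TensorProduct.sum_tmul, Algebra.TensorProduct.one_def]

lemma eq_counit_of_conv_self {C : Type} [AddCommGroup C] [Module k C] [Coalgebra k C]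
    {s t : C →ₗ[k] k} (h : conv s t = counit) (hs : conv s s = s) : s = counit := by
  rw [← conv_counit s, ← h, ← conv_assoc, hs]

lemma right_eq_counit {C : Type} [AddCommGroup C] [Module k C] [Coalgebra k C]
    {s t : C →ₗ[k] k} (h : conv s t = counit) (hs : s = counit) : t = counit := by
  subst hs
  rw [← counit_conv t, h]

lemma cocycle_oneTmul (hinv₁ : conv σ σi = counit) (hone : σ ((1 : A) ⊗ₜ (1 : A)) = 1)
    (hcoc : ∀ x y z : A,
      conv σ (σ ∘ₗ ((TensorProduct.mk k A A).flip z) ∘ₗ LinearMap.mul' k A) (x ⊗ₜ y)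
        = conv σ (σ ∘ₗ (TensorProduct.mk k A A x) ∘ₗ LinearMap.mul' k A) (y ⊗ₜ z)) :
    σ ∘ₗ (oneTmul k A).toLinearMap = counit := by
  refine eq_counit_of_conv_self (conv_comp_coalgHom_eq_counit hinv₁ _) ?_
  ext z
  have h := hcoc 1 1 z
  trans conv σ (σ ∘ₗ (TensorProduct.mk k A A 1) ∘ₗ LinearMap.mul' k A) (1 ⊗ₜ z)
  · change _ = (conv _ _ ∘ₗ (oneTmul k A).toLinearMap) z
    rw [conv_comp]
    congr 2
    ext z
    simp [oneTmul]
  · rw [← h]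
    simp [conv, hone, Algebra.TensorProduct.one_def, oneTmul]

lemma cocycle_tmulOne (hinv₁ : conv σ σi = counit) (hone : σ ((1 : A) ⊗ₜ (1 : A)) = 1)
    (hcoc : ∀ x y z : A,
      conv σ (σ ∘ₗ ((TensorProduct.mk k A A).flip z) ∘ₗ LinearMap.mul' k A) (x ⊗ₜ y)
        = conv σ (σ ∘ₗ (TensorProduct.mk k A A x) ∘ₗ LinearMap.mul' k A) (y ⊗ₜ z)) :
    σ ∘ₗ (tmulOne k A).toLinearMap = counit := by
  refine eq_counit_of_conv_self (conv_comp_coalgHom_eq_counit hinv₁ _) ?_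
  ext z
  have h := hcoc z 1 1
  trans conv σ (σ ∘ₗ ((TensorProduct.mk k A A).flip 1) ∘ₗ LinearMap.mul' k A) (z ⊗ₜ 1)
  · change _ = (conv _ _ ∘ₗ (tmulOne k A).toLinearMap) z
    rw [conv_comp]
    congr 2
    ext z
    simp [tmulOne]
  · rw [h]
    simp [conv, hone, Algebra.TensorProduct.one_def, tmulOne]

lemma conv_comp_mk_flip {C D M ι : Type} [AddCommGroup C] [Module k C] [Coalgebra k C]
    [AddCommGroup D] [Module k D] [Coalgebra k D] [Ring M] [Algebra k M]
    (f g : C ⊗[k] D →ₗ[k] M) {d : D} (r : Repr k d ι) :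
    conv f g ∘ₗ (TensorProduct.mk k C D).flip d
      = ∑ i ∈ r.index, conv (f ∘ₗ (TensorProduct.mk k C D).flip (r.left i))
          (g ∘ₗ (TensorProduct.mk k C D).flip (r.right i)) := by
  ext c
  simp only [LinearMap.comp_apply, LinearMap.flip_apply, TensorProduct.mk_apply,
    conv_tmul (ℛ k c) r, LinearMap.sum_apply, conv_apply (ℛ k c)]
  exact Finset.sum_comm

lemma antipodeRight_mul' :
    antipodeRight (LinearMap.mul' k A) = Algebra.linearMap k A ∘ₗ counit :=
  HopfAlgebra.mul_antipode_lTensor_comul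

lemma antipodeLeft_mul' :
    antipodeLeft (LinearMap.mul' k A) = Algebra.linearMap k A ∘ₗ counit :=
  HopfAlgebra.mul_antipode_rTensor_comul

lemma antipodeRight_conv_mulTmul (hl : σi ∘ₗ (oneTmul k A).toLinearMap = counit) (c : A) :
    antipodeRight (conv (σ ∘ₗ (tmulMul k A).toLinearMap) (σi ∘ₗ (mulTmul k A).toLinearMap) ∘ₗ
        (TensorProduct.mk k (A ⊗[k] A) A).flip c)
      = antipodeRight (σ ∘ₗ (tmulMul k A).toLinearMap ∘ₗ
          (TensorProduct.mk k (A ⊗[k] A) A).flip c) := by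
  have hg (c : A) : antipodeRight ((σi ∘ₗ (mulTmul k A).toLinearMap) ∘ₗ
      (TensorProduct.mk k (A ⊗[k] A) A).flip c)
        = Algebra.linearMap k k ∘ₗ ((counit (R := k) c) • counit) := by
    ext a
    have h := congr(σi ($(sum_mul_antipode_eq_smul (ℛ k a)) ⊗ₜ c))
    have h' : σi (1 ⊗ₜ c) = counit c := congr($hl c)
    rw [antipodeRight_apply (ℛ k a)]
    simp only [TensorProduct.sum_tmul, map_sum, ← TensorProduct.smul_tmul', map_smul, h'] at h
    simpa [mul_comm] using h
  rw [conv_comp_mk_flip _ _ (ℛ k c)]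
  have h := fun i ↦ antipodeRight_conv ((σ ∘ₗ (tmulMul k A).toLinearMap) ∘ₗ
    (TensorProduct.mk k (A ⊗[k] A) A).flip ((ℛ k c).left i)) _ _ (hg ((ℛ k c).right i))
  ext a
  trans ∑ i ∈ (ℛ k c).index, antipodeRight (conv ((σ ∘ₗ (tmulMul k A).toLinearMap) ∘ₗ
    (TensorProduct.mk k (A ⊗[k] A) A).flip ((ℛ k c).left i)) ((σi ∘ₗ (mulTmul k A).toLinearMap) ∘ₗ
    (TensorProduct.mk k (A ⊗[k] A) A).flip ((ℛ k c).right i))) a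
  · simp [antipodeRight]
  simp only [h]
  have hs (t : k) : conv (Algebra.linearMap k A ∘ₗ (t • counit)) (antipode k)
      = t • antipode k (A := A) := by
    rw [LinearMap.comp_smul]
    conv_rhs => rw [← one_conv (antipode k (A := A))]
    ext; simp [conv, TensorProduct.map_smul_left]
  have hc : ∑ i ∈ (ℛ k c).index, counit (R := k) ((ℛ k c).right i) • (ℛ k c).left i = c := by
    simpa [conv_one] using (conv_scalar_apply (ℛ k c) counit (LinearMap.id : A →ₗ[k] A)).symm
  conv_rhs => rw [← hc]
  simp [hs, TensorProduct.map_smul_right, antipodeRight]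

lemma antipodeRight_conv_scalarMap (c : A) :
    antipodeRight
      (conv (scalarMap counit σi ∘ₗ (assocHom k A).toLinearMap) (scalarMap σ counit) ∘ₗ
        (TensorProduct.mk k (A ⊗[k] A) A).flip c)
      = conv (antipodeRight σ) (σi ∘ₗ (TensorProduct.mk k A A).flip c ∘ₗ antipode k) := by
  ext a
  have h := comp_map_conv_scalar_comp_comul σ LinearMap.id (antipode k)
    (σi ∘ₗ (TensorProduct.mk k A A).flip c ∘ₗ antipode k)
  have hG (a b : A) (r : Repr k b (A × A)) :
      conv (scalarMap counit σi ∘ₗ (assocHom k A).toLinearMap) (scalarMap σ counit) ((a ⊗ₜ b) ⊗ₜ c)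
        = ∑ i ∈ r.index, σi (r.left i ⊗ₜ c) * σ (a ⊗ₜ r.right i) := by
    have hc : ∑ i ∈ (ℛ k c).index, counit (R := k) ((ℛ k c).right i) • (ℛ k c).left i = c := by
      simpa [conv_one] using (conv_scalar_apply (ℛ k c) counit (LinearMap.id : A →ₗ[k] A)).symm
    have ha := sum_counit_smul (ℛ k a)
    rw [conv_tmul ((ℛ k a).tmul r) (ℛ k c)]
    conv_rhs => rw [← hc, ← ha]
    simp only [Coalgebra.Repr.tmul_index, Coalgebra.Repr.tmul_left, Coalgebra.Repr.tmul_right,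
      Finset.sum_product, TensorProduct.tmul_sum, TensorProduct.sum_tmul, map_sum,
      Finset.sum_mul_sum, TensorProduct.tmul_smul, ← TensorProduct.smul_tmul', map_smul,
      smul_eq_mul, scalarMap_tmul, LinearMap.comp_apply]
    rw [Finset.sum_comm]
    refine Finset.sum_congr rfl fun i _ ↦ ?_
    rw [Finset.sum_comm]
    refine Finset.sum_congr rfl fun j _ ↦ Finset.sum_congr rfl fun l _ ↦ ?_
    change (counit ((ℛ k a).left l) * σi (r.left i ⊗ₜ (ℛ k c).left j)) *
      (σ ((ℛ k a).right l ⊗ₜ r.right i) * counit ((ℛ k c).right j)) = _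
    ring
  trans (σ ∘ₗ TensorProduct.map LinearMap.id (conv (antipode k) (Algebra.linearMap k A ∘ₗ
    σi ∘ₗ (TensorProduct.mk k A A).flip c ∘ₗ antipode k)) ∘ₗ comul) a
  · rw [antipodeRight_apply (ℛ k a)]
    simp only [LinearMap.comp_apply, LinearMap.flip_apply, TensorProduct.mk_apply]
    rw [← (ℛ k a).eq]
    simp only [map_sum, TensorProduct.map_tmul, LinearMap.id_apply]
    refine Finset.sum_congr rfl fun i _ ↦ ?_
    rw [hG _ _ (antipodeRepr (ℛ k _)), conv_scalar_apply (ℛ k _)]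
    simp [TensorProduct.tmul_sum]
  · exact congr($h a)

lemma conv_antipodeRight_antipodeLeft (hinv₁ : conv σ σi = counit) (hinv₂ : conv σi σ = counit)
    (hone : σ ((1 : A) ⊗ₜ (1 : A)) = 1)
    (hcoc : ∀ x y z : A,
      conv σ (σ ∘ₗ ((TensorProduct.mk k A A).flip z) ∘ₗ LinearMap.mul' k A) (x ⊗ₜ y)
        = conv σ (σ ∘ₗ (TensorProduct.mk k A A x) ∘ₗ LinearMap.mul' k A) (y ⊗ₜ z)) :
    conv (antipodeRight σ) (antipodeLeft σi) = counit := by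
  have hl := right_eq_counit (conv_comp_coalgHom_eq_counit hinv₁ (oneTmul k A))
    (cocycle_oneTmul hinv₁ hone hcoc)
  have hr := cocycle_tmulOne hinv₁ hone hcoc
  have hK : conv (scalarMap counit σi ∘ₗ (assocHom k A).toLinearMap) (scalarMap σ counit)
      = conv (σ ∘ₗ (tmulMul k A).toLinearMap) (σi ∘ₗ (mulTmul k A).toLinearMap) := by
    have h₁ : conv (scalarMap counit σi ∘ₗ (assocHom k A).toLinearMap)
        (scalarMap counit σ ∘ₗ (assocHom k A).toLinearMap) = counit :=
      conv_comp_coalgHom_eq_counit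
        (by rw [conv_scalarMap, hinv₂, counit_conv, scalarMap_counit_counit]) (assocHom k A)
    rw [← conv_counit (scalarMap σ counit), ← conv_comp_coalgHom_eq_counit hinv₁ (mulTmul k A),
      ← conv_assoc (scalarMap σ counit), cocycle_conv hcoc, conv_assoc, ← conv_assoc, h₁,
      counit_conv]
  have hc (a c : A) :
      conv (antipodeRight σ) (σi ∘ₗ (TensorProduct.mk k A A).flip c ∘ₗ antipode k) a
      = antipodeRight (σ ∘ₗ (tmulMul k A).toLinearMap ∘ₗ
          (TensorProduct.mk k (A ⊗[k] A) A).flip c) a := by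
    rw [← antipodeRight_conv_scalarMap, hK, antipodeRight_conv_mulTmul hl]
  ext x
  have hco := sum_tmul_tmul_eq (R := k) (ℛ k x) (fun _ ↦ ℛ k _) (fun _ ↦ ℛ k _)
  have h₁ := congr((LinearMap.mul' k k ∘ₗ TensorProduct.map (antipodeRight σ)
    (σi ∘ₗ TensorProduct.map (antipode k) LinearMap.id)) $hco)
  have h₂ := congr((σ ∘ₗ TensorProduct.map LinearMap.id
    (LinearMap.mul' k A ∘ₗ TensorProduct.map (antipode k) LinearMap.id)) $hco)
  simp only [map_sum] at h₁ h₂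
  rw [conv_apply (ℛ k x)]
  calc _ = ∑ i ∈ (ℛ k x).index, conv (antipodeRight σ)
        (σi ∘ₗ (TensorProduct.mk k A A).flip ((ℛ k x).right i) ∘ₗ antipode k) ((ℛ k x).left i) := by
        convert h₁.symm using 2 with i _ i _
        · simp [antipodeLeft_apply (ℛ k _), Finset.mul_sum]
        · simp [conv_apply (ℛ k _)]
    _ = ∑ i ∈ (ℛ k x).index, counit (R := k) ((ℛ k x).right i) * σ ((ℛ k x).left i ⊗ₜ 1) := by
        simp only [hc]
        convert h₂ using 2 with i _ i _
        · simp [antipodeRight_apply (ℛ k _)]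
        · have := sum_antipode_mul_eq_smul (R := k) (ℛ k ((ℛ k x).right i))
          simp only [LinearMap.comp_apply, TensorProduct.map_tmul, LinearMap.mul'_apply,
            LinearMap.id_apply, ← map_sum, ← TensorProduct.tmul_sum, this, TensorProduct.tmul_smul,
            map_smul, smul_eq_mul]
    _ = counit x := by
        have h (y : A) : σ (y ⊗ₜ 1) = counit y := congr($hr y)
        simp only [h, mul_comm, ← smul_eq_mul, ← map_smul, ← map_sum]
        rw [sum_counit_smul]

lemma antipodeLeft_linearMap_comp (s : A ⊗[k] A →ₗ[k] k) :
    antipodeLeft (Algebra.linearMap k A ∘ₗ s) = Algebra.linearMap k A ∘ₗ antipodeLeft s := rfl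

lemma antipodeRight_linearMap_comp (s : A ⊗[k] A →ₗ[k] k) :
    antipodeRight (Algebra.linearMap k A ∘ₗ s) = Algebra.linearMap k A ∘ₗ antipodeRight s := rfl

lemma exists_twist_antipode (hinv₁ : conv σ σi = counit) (hinv₂ : conv σi σ = counit)
    (hone : σ ((1 : A) ⊗ₜ (1 : A)) = 1)
    (hcoc : ∀ x y z : A,
      conv σ (σ ∘ₗ ((TensorProduct.mk k A A).flip z) ∘ₗ LinearMap.mul' k A) (x ⊗ₜ y)
        = conv σ (σ ∘ₗ (TensorProduct.mk k A A x) ∘ₗ LinearMap.mul' k A) (y ⊗ₜ z)) :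
    ∃ S' : A →ₗ[k] A,
      twistMul σ σi ∘ₗ TensorProduct.map S' LinearMap.id ∘ₗ comul
          = Algebra.linearMap k A ∘ₗ counit ∧
      twistMul σ σi ∘ₗ TensorProduct.map LinearMap.id S' ∘ₗ comul
          = Algebra.linearMap k A ∘ₗ counit := by
  have hu := conv_antipodeRight_antipodeLeft hinv₁ hinv₂ hone hcoc
  refine ⟨conv (Algebra.linearMap k A ∘ₗ antipodeRight σ)
    (conv (antipode k) (Algebra.linearMap k A ∘ₗ antipodeLeft σi)), ?_, ?_⟩
  · have h : conv (Algebra.linearMap k A ∘ₗ σi) (twistMul σ σi)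
        = conv (LinearMap.mul' k A) (Algebra.linearMap k A ∘ₗ σi) := by
      rw [twistMul, conv_assoc, ← conv_assoc, ← linearMap_comp_conv, hinv₂, one_conv]
    rw [comp_map_scalar_conv_comp_comul, ← antipodeLeft_conv (Algebra.linearMap k A ∘ₗ σi)
        (twistMul σ σi) (antipodeLeft σi) (antipodeLeft_linearMap_comp σi),
      h, antipodeLeft_conv _ _ _ antipodeLeft_mul', conv_one]
    change conv _ (antipodeLeft (Algebra.linearMap k A ∘ₗ σi)) = _
    rw [antipodeLeft_linearMap_comp, ← linearMap_comp_conv, hu]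
  · have h : conv (twistMul σ σi) (Algebra.linearMap k A ∘ₗ σ)
        = conv (Algebra.linearMap k A ∘ₗ σ) (LinearMap.mul' k A) := by
      rw [twistMul, conv_assoc, ← linearMap_comp_conv, hinv₂, conv_one]
    rw [← conv_assoc, comp_map_conv_scalar_comp_comul,
      ← antipodeRight_conv (twistMul σ σi) (Algebra.linearMap k A ∘ₗ σ) (antipodeRight σ)
        (antipodeRight_linearMap_comp σ),
      h, antipodeRight_conv _ _ _ antipodeRight_mul', one_conv]
    change conv (antipodeRight (Algebra.linearMap k A ∘ₗ σ)) _ = _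
    rw [antipodeRight_linearMap_comp, ← linearMap_comp_conv, hu]

end Cocycle

theorem twist_isHopfAlgebra (σ σi : A ⊗[k] A →ₗ[k] k)
    -- σ is convolution-invertible with inverse σi
    (hinv₁ : conv σ σi = Coalgebra.counit) (hinv₂ : conv σi σ = Coalgebra.counit)
    -- σ(1,1) = 1
    (hone : σ ((1 : A) ⊗ₜ (1 : A)) = 1)
    -- the 2-cocycle identity Σ σ(x₁,y₁)σ(x₂y₂,z) = Σ σ(y₁,z₁)σ(x,y₂z₂)
    (hcoc : ∀ x y z : A,
      conv σ (σ ∘ₗ ((TensorProduct.mk k A A).flip z) ∘ₗ LinearMap.mul' k A) (x ⊗ₜ y)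
        = conv σ (σ ∘ₗ (TensorProduct.mk k A A x) ∘ₗ LinearMap.mul' k A) (y ⊗ₜ z)) :
    -- the twisted multiplication is associative
    (∀ x y z : A,
      twistMul σ σi ((twistMul σ σi (x ⊗ₜ y)) ⊗ₜ z)
        = twistMul σ σi (x ⊗ₜ (twistMul σ σi (y ⊗ₜ z)))) ∧
    -- with unit 1
    (∀ x : A, twistMul σ σi ((1 : A) ⊗ₜ x) = x ∧ twistMul σ σi (x ⊗ₜ (1 : A)) = x) ∧
    -- Δ is an algebra homomorphism for the twisted multiplication
    (∀ x y : A,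
      Coalgebra.comul (R := k) (twistMul σ σi (x ⊗ₜ y))
        = ((TensorProduct.map (twistMul σ σi) (twistMul σ σi)) ∘ₗ
            (TensorProduct.tensorTensorTensorComm k A A A A).toLinearMap)
          ((Coalgebra.comul (R := k) x) ⊗ₜ (Coalgebra.comul (R := k) y))) ∧
    (Coalgebra.comul (R := k) (1 : A) = (1 : A) ⊗ₜ (1 : A)) ∧
    -- ε is an algebra homomorphism for the twisted multiplication
    (∀ x y : A,
      Coalgebra.counit (R := k) (twistMul σ σi (x ⊗ₜ y))
        = Coalgebra.counit (R := k) x * Coalgebra.counit (R := k) y) ∧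
    (Coalgebra.counit (R := k) (1 : A) = 1) ∧
    -- A_σ admits an antipode
    (∃ S' : A →ₗ[k] A,
      twistMul σ σi ∘ₗ TensorProduct.map S' LinearMap.id ∘ₗ Coalgebra.comul
          = Algebra.linearMap k A ∘ₗ Coalgebra.counit ∧
      twistMul σ σi ∘ₗ TensorProduct.map LinearMap.id S' ∘ₗ Coalgebra.comul
          = Algebra.linearMap k A ∘ₗ Coalgebra.counit) := by
  have hl := cocycle_oneTmul hinv₁ hone hcoc
  have hr := cocycle_tmulOne hinv₁ hone hcoc
  have hmul : comul ∘ₗ twistMul σ σi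
      = TensorProduct.map (twistMul σ σi) (twistMul σ σi) ∘ₗ comul :=
    comul_comp_convTwist hinv₂ (Bialgebra.mulCoalgHom k A).map_comp_comul.symm
  have hcounit : counit ∘ₗ twistMul σ σi = counit := by
    rw [twistMul_eq, comp_convTwist,
      show counit ∘ₗ LinearMap.mul' k A = counit from (Bialgebra.mulCoalgHom k A).counit_comp]
    exact convTwist_counit hinv₁
  refine ⟨fun x y z ↦ congr($(twistMul_assoc hinv₁ hinv₂ hcoc) ((x ⊗ₜ y) ⊗ₜ z)),
    fun x ↦ ⟨?_, ?_⟩, fun x y ↦ congr($hmul (x ⊗ₜ y)), Bialgebra.comul_one,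
    fun x y ↦ ?_, Bialgebra.counit_one, exists_twist_antipode hinv₁ hinv₂ hone hcoc⟩
  · have h : twistMul σ σi ∘ₗ (oneTmul k A).toLinearMap = LinearMap.id := by
      rw [twistMul_eq, convTwist_comp, hl,
        right_eq_counit (conv_comp_coalgHom_eq_counit hinv₁ (oneTmul k A)) hl,
        convTwist_counit_counit]
      ext x
      exact one_mul x
    exact congr($h x)
  · have h : twistMul σ σi ∘ₗ (tmulOne k A).toLinearMap = LinearMap.id := by
      rw [twistMul_eq, convTwist_comp, hr,
        right_eq_counit (conv_comp_coalgHom_eq_counit hinv₁ (tmulOne k A)) hr,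
        convTwist_counit_counit]
      ext x
      exact mul_one x
    exact congr($h x)
  · rw [mul_comm]
    exact congr($hcounit (x ⊗ₜ y))

end
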